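/- arXiv:0906.0205 — 6 statements merged into one kernel-verified Lean document; each statement's English description precedes it below -/
import Mathlib

section
/- Let S = {S_1, …, S_m} be a finite collection of finite nonempty sets with U(S) = {v_1, …, v_n}, and for each i ∈ {1, …, n} let R_i = {j ∈ {1, …, m} : v_i ∈ S_j}. Suppose 𝒯 is a tree with vertex set U(S) such that every S_j induces a connected subgraph of 𝒯. Then the graph 𝒯′ with vertex set {1, …, n} and edges {i, k} exactly when {v_i, v_k} is an edge of 𝒯 is a join tree for the family (R_i)_{i=1,…,n}. -/
/-- A join tree for a family of sets `E` indexed by `ι`: a tree `T` on vertex set `ι`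
such that for all `i j` and every `a ∈ E i ∩ E j`, every vertex on the (unique) path
in `T` from `i` to `j` belongs to the set `{k | a ∈ E k}`. -/
def IsJoinTree {ι α : Type*} (T : SimpleGraph ι) (E : ι → Set α) : Prop :=
  T.IsTree ∧ ∀ (i j : ι) (a : α), a ∈ E i → a ∈ E j →
    ∀ p : T.Walk i j, p.IsPath → ∀ k ∈ p.support, a ∈ E k

/-- In an acyclic graph, a vertex set inducing a preconnected subgraph contains every path
between two of its vertices. -/
theorem SimpleGraph.IsAcyclic.mem_of_mem_support_of_induce_preconnected {V : Type*}
    {G : SimpleGraph V} (hG : G.IsAcyclic) {s : Set V} (hs : (G.induce s).Preconnected)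
    {u v w : V} (hu : u ∈ s) (hv : v ∈ s) {p : G.Walk u v} (hp : p.IsPath)
    (hw : w ∈ p.support) : w ∈ s := by
  obtain ⟨q, hq⟩ := (hs ⟨u, hu⟩ ⟨v, hv⟩).exists_isPath
  let f := SimpleGraph.Embedding.induce (G := G) s
  have := hG.subsingleton_path u v
  have hpq : p = q.map f.toHom :=
    congrArg Subtype.val (Subsingleton.elim (α := G.Path u v) ⟨p, hp⟩
      ⟨q.map f.toHom, hq.map f.injective⟩)
  have hwq : w ∈ (q.map f.toHom).support := hpq ▸ hw
  rw [SimpleGraph.Walk.support_map, List.mem_map] at hwq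
  obtain ⟨x, -, rfl⟩ := hwq
  exact x.2

/-- if `𝒯` is a tree on the vertices `v_1, …, v_n` (modeled as `Fin n`,
identifying `v_i` with `i`) with respect to which every `S_j` induces a connected
subgraph, then the graph `𝒯′` on the index set `{1, …, n}` whose edges `{i,k}` are
exactly the pairs with `{v_i, v_k}` an edge of `𝒯` is a join tree for the dual family
`R i = {j | v i ∈ S j}`. -/
theorem joinTree_of_treeConvex (m n : ℕ) (S : Fin m → Set (Fin n))
    (hne : ∀ j, (S j).Nonempty) (hU : (⋃ j, S j) = Set.univ)
    (T : SimpleGraph (Fin n)) (hT : T.IsTree)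
    (hconn : ∀ j, (T.induce (S j)).Connected)
    (T' : SimpleGraph (Fin n)) (hT' : ∀ i k, T'.Adj i k ↔ T.Adj i k) :
    IsJoinTree T' (fun i => {j | i ∈ S j}) := by
  obtain rfl : T' = T := by
    ext i k
    exact hT' i k
  exact ⟨hT, fun i j a hi hj p hp k hk =>
    hT.isAcyclic.mem_of_mem_support_of_induce_preconnected (hconn a).preconnected hi hj hp hk⟩
end

section
/- Let S = {S_1, …, S_m} be a finite collection of finite nonempty sets with U(S) = {v_1, …, v_n}, and for each i ∈ {1, …, n} let R_i = {j ∈ {1, …, m} : v_i ∈ S_j}. Suppose 𝒯′ is a tree with vertex set {1, …, n} that is a join tree for the family (R_i)_{i=1,…,n}. Then the graph 𝒯 with vertex set U(S) and edges {v_i, v_k} exactly when {i, k} is an edge of 𝒯′ is a tree, and every S_j induces a connected subgraph of 𝒯; in particular S is tree convex. -/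
/-- if `𝒯′` is a join tree on the index set `{1, …, n}` for the dual
family `R i = {j | v i ∈ S j}`, then the graph `𝒯` on the vertices `v_1, …, v_n`
(modeled as `Fin n`, identifying `v_i` with `i`) whose edges `{v_i, v_k}` are exactly
the pairs with `{i, k}` an edge of `𝒯′` is a tree, every `S_j` induces a connected
subgraph of `𝒯`; in particular `S` is tree convex. -/
theorem treeConvex_of_joinTree (m n : ℕ) (S : Fin m → Set (Fin n))
    (hne : ∀ j, (S j).Nonempty) (hU : (⋃ j, S j) = Set.univ)
    (T' : SimpleGraph (Fin n))
    (hJT : IsJoinTree T' (fun i => {j | i ∈ S j}))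
    (T : SimpleGraph (Fin n)) (hT : ∀ i k, T.Adj i k ↔ T'.Adj i k) :
    (T.IsTree ∧ ∀ j, (T.induce (S j)).Connected) ∧
      (∃ T'' : SimpleGraph (Fin n), T''.IsTree ∧ ∀ j, (T''.induce (S j)).Connected) := by
  obtain rfl : T = T' := SimpleGraph.ext (by ext i k; exact hT i k)
  have hS : ∀ j, (T.induce (S j)).Connected := fun j => by
    have : Nonempty (S j) := (hne j).to_subtype
    refine ⟨fun x y => ?_⟩
    obtain ⟨p, hp⟩ := (hJT.1.connected x.1 y.1).exists_isPath
    exact ⟨p.induce (S j) fun k hk => hJT.2 x.1 y.1 j x.2 y.2 p hp k hk⟩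
  exact ⟨⟨hJT.1, hS⟩, T, hJT.1, hS⟩
end

section
/- Let H be a finite hypergraph given by a nonempty finite family of finite nonempty hyperedges (E_i)_{i∈I} over the vertex set N = ⋃_{i∈I} E_i. Then H is acyclic if and only if the family (E_i)_{i∈I} has a join tree. -/
namespace HyperAcyclic

variable {α : Type*}

/-- The reduction of a family of edges: remove every edge properly contained in
another edge.  (The removal of non-edge nodes is implicit in this edge-set
representation of hypergraphs.) -/
def Reduction (𝓔 : Set (Set α)) : Set (Set α) :=
  {X ∈ 𝓔 | ¬ ∃ Y ∈ 𝓔, X ⊂ Y}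

/-- The set of partial edges generated by a set `M` of nodes: the reduction of
`{E ∩ M | E ∈ 𝓔}` with the empty set removed. -/
def PartialEdges (𝓔 : Set (Set α)) (M : Set α) : Set (Set α) :=
  Reduction ({X | ∃ E ∈ 𝓔, X = E ∩ M} \ {∅})

/-- Two edges of `𝓕` are connected if there is a path between them, i.e. a sequence
of edges of `𝓕` in which consecutive edges intersect. -/
def Conn (𝓕 : Set (Set α)) (X Y : Set α) : Prop :=
  X ∈ 𝓕 ∧ Relation.ReflTransGen (fun U W => W ∈ 𝓕 ∧ (U ∩ W).Nonempty) X Y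

/-- A set of edges is connected if every pair of its edges is connected. -/
def IsConnectedSet (𝓕 : Set (Set α)) : Prop :=
  ∀ X ∈ 𝓕, ∀ Y ∈ 𝓕, Conn 𝓕 X Y

/-- The connected components of a set of edges: the maximal connected subsets,
i.e. the equivalence classes under connectedness. -/
def Components (𝓕 : Set (Set α)) : Set (Set (Set α)) :=
  {C | ∃ X ∈ 𝓕, C = {Y | Conn 𝓕 X Y}}

/-- The number of connected components. -/
noncomputable def NumComponents (𝓕 : Set (Set α)) : ℕ :=
  (Components 𝓕).ncard

/-- `𝓕` has an articulation set if there is a pair `(X, Y)` of its edges such that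
removing `X ∩ Y` from every edge of `𝓕` strictly increases the number of connected
components. -/
def HasArticulationSet (𝓕 : Set (Set α)) : Prop :=
  ∃ X ∈ 𝓕, ∃ Y ∈ 𝓕,
    NumComponents 𝓕 <
      NumComponents ({Z | ∃ W ∈ 𝓕, Z = W \ (X ∩ Y)} \ {∅})

/-- A reduced hypergraph is acyclic if all of its blocks — the connected
node-generated sets of partial edges without articulation set — have fewer than two
edges. -/
def ReducedAcyclic (𝓔 : Set (Set α)) : Prop :=
  ∀ M : Set α,
    IsConnectedSet (PartialEdges 𝓔 M) → ¬ HasArticulationSet (PartialEdges 𝓔 M) →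
      (PartialEdges 𝓔 M).ncard < 2

/-- A hypergraph is acyclic if its reduction is acyclic. -/
def Acyclic (𝓔 : Set (Set α)) : Prop :=
  ReducedAcyclic (Reduction 𝓔)

end HyperAcyclic

namespace HyperAcyclic

variable {α ι : Type*} {𝓐 𝓑 𝓔 𝓕 : Set (Set α)} {M X Y Z : Set α}

theorem exists_subset_mem_reduction [Finite α] (hX : X ∈ 𝓔) : ∃ Y ∈ Reduction 𝓔, X ⊆ Y := by
  obtain ⟨Y, hXY, hY⟩ := 𝓔.toFinite.exists_le_maximal hX
  exact ⟨Y, ⟨hY.prop, fun ⟨Z, hZ, hYZ⟩ => hYZ.not_subset (hY.le_of_ge hZ hYZ.subset)⟩, hXY⟩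

theorem eq_of_mem_reduction (hX : X ∈ Reduction 𝓔) (hY : Y ∈ 𝓔) (h : X ⊆ Y) : X = Y := by
  by_contra hne
  exact hX.2 ⟨Y, hY, h.ssubset_of_ne hne⟩

theorem isAntichain_reduction (𝓔 : Set (Set α)) : IsAntichain (· ⊆ ·) (Reduction 𝓔) :=
  fun _ hX _ hY hne h => hne (eq_of_mem_reduction hX hY.1 h)

theorem reduction_eq_self (h : IsAntichain (· ⊆ ·) 𝓔) : Reduction 𝓔 = 𝓔 :=
  Set.Subset.antisymm (fun _ hX => hX.1)
    fun _ hX => ⟨hX, fun ⟨_, hY, hXY⟩ => hXY.ne (h.eq hX hY hXY.subset)⟩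

theorem reduction_subset_of_cofinal (h₁ : ∀ X ∈ 𝓐, ∃ Y ∈ 𝓑, X ⊆ Y)
    (h₂ : ∀ X ∈ 𝓑, ∃ Y ∈ 𝓐, X ⊆ Y) : Reduction 𝓐 ⊆ Reduction 𝓑 := by
  intro X hX
  obtain ⟨Y, hY, hXY⟩ := h₁ X hX.1
  obtain ⟨Z, hZ, hYZ⟩ := h₂ Y hY
  have hXZ := eq_of_mem_reduction hX hZ (hXY.trans hYZ)
  have hXY' : X = Y := hXY.antisymm (hXZ ▸ hYZ)
  refine ⟨hXY' ▸ hY, fun ⟨W, hW, hXW⟩ => ?_⟩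
  obtain ⟨V, hV, hWV⟩ := h₂ W hW
  exact hX.2 ⟨V, hV, hXW.trans_subset hWV⟩

/-- Families that are cofinal in each other with respect to inclusion have the same reduction. -/
theorem reduction_congr (h₁ : ∀ X ∈ 𝓐, ∃ Y ∈ 𝓑, X ⊆ Y) (h₂ : ∀ X ∈ 𝓑, ∃ Y ∈ 𝓐, X ⊆ Y) :
    Reduction 𝓐 = Reduction 𝓑 :=
  (reduction_subset_of_cofinal h₁ h₂).antisymm (reduction_subset_of_cofinal h₂ h₁)

theorem exists_eq_inter_of_mem_partialEdges (hX : X ∈ PartialEdges 𝓔 M) :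
    ∃ E ∈ 𝓔, X = E ∩ M :=
  hX.1.1

theorem nonempty_of_mem_partialEdges (hX : X ∈ PartialEdges 𝓔 M) : X.Nonempty :=
  Set.nonempty_iff_ne_empty.2 hX.1.2

theorem exists_subset_mem_partialEdges [Finite α] (hX : X ∈ 𝓔) (h : (X ∩ M).Nonempty) :
    ∃ Y ∈ PartialEdges 𝓔 M, X ∩ M ⊆ Y :=
  exists_subset_mem_reduction ⟨⟨X, hX, rfl⟩, h.ne_empty⟩

theorem partialEdges_reduction [Finite α] (𝓔 : Set (Set α)) (M : Set α) :
    PartialEdges (Reduction 𝓔) M = PartialEdges 𝓔 M := by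
  refine reduction_congr ?_ ?_
  · rintro _ ⟨⟨E, hE, rfl⟩, h⟩
    exact ⟨E ∩ M, ⟨⟨E, hE.1, rfl⟩, h⟩, subset_rfl⟩
  · rintro _ ⟨⟨E, hE, rfl⟩, h⟩
    obtain ⟨Y, hY, hEY⟩ := exists_subset_mem_reduction hE
    have hsub : E ∩ M ⊆ Y ∩ M := Set.inter_subset_inter_left M hEY
    exact ⟨Y ∩ M, ⟨⟨Y, hY, rfl⟩, ((Set.nonempty_iff_ne_empty.2 h).mono hsub).ne_empty⟩, hsub⟩

theorem partialEdges_partialEdges [Finite α] (𝓔 : Set (Set α)) (N M : Set α) :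
    PartialEdges (PartialEdges 𝓔 N) M = PartialEdges 𝓔 (N ∩ M) := by
  refine reduction_congr ?_ ?_
  · rintro _ ⟨⟨X, hX, rfl⟩, h⟩
    obtain ⟨E, hE, rfl⟩ := exists_eq_inter_of_mem_partialEdges hX
    exact ⟨E ∩ (N ∩ M), ⟨⟨E, hE, rfl⟩, by rwa [← Set.inter_assoc]⟩, by rw [Set.inter_assoc]⟩
  · rintro _ ⟨⟨E, hE, rfl⟩, h⟩
    have hne : (E ∩ (N ∩ M)).Nonempty := Set.nonempty_iff_ne_empty.2 h
    obtain ⟨Y, hY, hEY⟩ := exists_subset_mem_partialEdges (M := N) hE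
      (hne.mono (Set.inter_subset_inter_right E Set.inter_subset_left))
    have hsub : E ∩ (N ∩ M) ⊆ Y ∩ M := by
      rw [← Set.inter_assoc]
      exact Set.inter_subset_inter_left M hEY
    exact ⟨Y ∩ M, ⟨⟨Y, hY, rfl⟩, (hne.mono hsub).ne_empty⟩, hsub⟩

theorem partialEdges_univ (h : IsAntichain (· ⊆ ·) 𝓔) (hne : ∀ X ∈ 𝓔, X.Nonempty) :
    PartialEdges 𝓔 Set.univ = 𝓔 := by
  have : ({X | ∃ E ∈ 𝓔, X = E ∩ Set.univ} \ {∅} : Set (Set α)) = 𝓔 := by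
    ext X
    simpa using fun hX => (hne X hX).ne_empty
  rw [PartialEdges, this, reduction_eq_self h]

theorem acyclic_iff [Finite α] : Acyclic 𝓔 ↔ ReducedAcyclic 𝓔 := by
  simp only [Acyclic, ReducedAcyclic, partialEdges_reduction]

theorem ReducedAcyclic.partialEdges [Finite α] (h : ReducedAcyclic 𝓔) (N : Set α) :
    ReducedAcyclic (PartialEdges 𝓔 N) := by
  intro M
  rw [partialEdges_partialEdges]
  exact h (N ∩ M)

theorem Conn.mem_right (h : Conn 𝓕 X Y) : Y ∈ 𝓕 := by
  obtain ⟨hX, h⟩ := h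
  induction h with
  | refl => exact hX
  | tail _ h _ => exact h.1

theorem Conn.tail (h : Conn 𝓕 X Y) (hZ : Z ∈ 𝓕) (hYZ : (Y ∩ Z).Nonempty) : Conn 𝓕 X Z :=
  ⟨h.1, h.2.tail ⟨hZ, hYZ⟩⟩

theorem numComponents_le_one (h : ∀ X ∈ 𝓕, ∀ Y ∈ 𝓕, Conn 𝓕 X Y) : NumComponents 𝓕 ≤ 1 := by
  have hsub : Components 𝓕 ⊆ {𝓕} := by
    rintro _ ⟨X, hX, rfl⟩
    exact Set.Subset.antisymm (fun Y hY => Conn.mem_right hY) fun Y hY => h X hX Y hY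
  simpa [NumComponents] using Set.ncard_le_ncard hsub

theorem one_lt_numComponents [Finite α] (hX : X ∈ 𝓕) (hY : Y ∈ 𝓕) (h : ¬ Conn 𝓕 X Y) :
    1 < NumComponents 𝓕 := by
  rw [NumComponents, Set.one_lt_ncard_iff_nontrivial]
  refine ⟨_, ⟨X, hX, rfl⟩, _, ⟨Y, hY, rfl⟩, fun heq => h ?_⟩
  have : Y ∈ {Z | Conn 𝓕 Y Z} := ⟨hY, .refl⟩
  rwa [← heq] at this

theorem one_le_numComponents [Finite α] (hX : X ∈ 𝓕) : 1 ≤ NumComponents 𝓕 :=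
  (Set.ncard_pos).2 ⟨_, X, hX, rfl⟩

/-- A family of nonempty edges that is not connected splits the nodes into two nonempty parts. -/
theorem exists_separation_of_not_conn (hne : ∀ Z ∈ 𝓕, Z.Nonempty) (hX : X ∈ 𝓕) (hY : Y ∈ 𝓕)
    (h : ¬ Conn 𝓕 X Y) :
    ∃ A B : Set α, A.Nonempty ∧ B.Nonempty ∧ Disjoint A B ∧ A ∪ B ⊆ ⋃₀ 𝓕 ∧
      ∀ Z ∈ 𝓕, Z ⊆ A ∨ Z ⊆ B := by
  have hA : ∀ Z, Conn 𝓕 X Z → Z ⊆ ⋃₀ {Z | Conn 𝓕 X Z} := fun Z hZ => Set.subset_sUnion_of_mem hZ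
  have hB : ∀ Z ∈ 𝓕, ¬ Conn 𝓕 X Z → Z ⊆ ⋃₀ 𝓕 \ ⋃₀ {Z | Conn 𝓕 X Z} := by
    rintro Z hZ hXZ a ha
    refine ⟨⟨Z, hZ, ha⟩, ?_⟩
    rintro ⟨W, hW, haW⟩
    exact hXZ (Conn.tail hW hZ ⟨a, haW, ha⟩)
  refine ⟨⋃₀ {Z | Conn 𝓕 X Z}, ⋃₀ 𝓕 \ ⋃₀ {Z | Conn 𝓕 X Z}, (hne X hX).mono (hA X ⟨hX, .refl⟩),
    (hne Y hY).mono (hB Y hY h), Set.disjoint_sdiff_right, ?_, fun Z hZ => ?_⟩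
  · exact Set.union_subset (Set.sUnion_subset_sUnion fun Z hZ => Conn.mem_right hZ)
      Set.sdiff_subset
  · by_cases hXZ : Conn 𝓕 X Z
    · exact .inl (hA Z hXZ)
    · exact .inr (hB Z hZ hXZ)

/-- A reduced acyclic family with at least two edges is separated by a set `S` of nodes, where `S`
is contained in two edges. -/
theorem ReducedAcyclic.exists_separator [Finite α] (h : ReducedAcyclic 𝓔)
    (hanti : IsAntichain (· ⊆ ·) 𝓔) (hne : ∀ X ∈ 𝓔, X.Nonempty) (hnt : 𝓔.Nontrivial) :
    ∃ S A B : Set α, A.Nonempty ∧ B.Nonempty ∧ Disjoint A B ∧ Disjoint S (A ∪ B) ∧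
      A ∪ B ⊆ ⋃₀ 𝓔 ∧ (∀ Z ∈ 𝓔, Z ⊆ A ∪ S ∨ Z ⊆ B ∪ S) ∧
      ∀ Z ∈ 𝓔, ¬ Z ⊆ S → ∃ F ∈ 𝓔, F ≠ Z ∧ S ⊆ F := by
  have hblock := h Set.univ
  rw [partialEdges_univ hanti hne] at hblock
  by_cases hconn : IsConnectedSet 𝓔
  · have hart : HasArticulationSet 𝓔 := by
      by_contra hart
      exact (hblock hconn hart).not_ge (Set.one_lt_ncard_iff_nontrivial.2 hnt)
    obtain ⟨X, hX, Y, hY, hlt⟩ := hart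
    set 𝓖 : Set (Set α) := {Z | ∃ W ∈ 𝓔, Z = W \ (X ∩ Y)} \ {∅}
    have hex : ∃ U ∈ 𝓖, ∃ V ∈ 𝓖, ¬ Conn 𝓖 U V := by
      by_contra! hall
      exact absurd (numComponents_le_one hall) ((one_le_numComponents hX).trans_lt hlt).not_ge
    obtain ⟨U, hU, V, hV, hUV⟩ := hex
    obtain ⟨A, B, hA, hB, hAB, hsub, hcover⟩ := exists_separation_of_not_conn
      (fun Z hZ => Set.nonempty_iff_ne_empty.2 hZ.2) hU hV hUV
    refine ⟨X ∩ Y, A, B, hA, hB, hAB, ?_, ?_, fun Z hZ => ?_, fun Z hZ hZS => ?_⟩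
    · refine Set.disjoint_left.2 fun a ha haAB => ?_
      obtain ⟨_, ⟨⟨W, -, rfl⟩, -⟩, haW⟩ := hsub haAB
      exact haW.2 ha
    · intro a ha
      obtain ⟨_, ⟨⟨W, hW, rfl⟩, -⟩, haW⟩ := hsub ha
      exact ⟨W, hW, haW.1⟩
    · by_cases hZS : Z \ (X ∩ Y) = ∅
      · exact .inl (Set.subset_union_of_subset_right (Set.sdiff_eq_empty.1 hZS) A)
      · have := hcover _ ⟨⟨Z, hZ, rfl⟩, hZS⟩
        rwa [Set.sdiff_subset_iff, Set.sdiff_subset_iff, Set.union_comm, Set.union_comm _ B] at this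
    · by_cases hXZ : X = Z
      · refine ⟨Y, hY, ?_, Set.inter_subset_right⟩
        rintro rfl
        exact hZS (by simp [hXZ])
      · exact ⟨X, hX, hXZ, Set.inter_subset_left⟩
  · simp only [IsConnectedSet, not_forall] at hconn
    obtain ⟨X, hX, Y, hY, hXY⟩ := hconn
    obtain ⟨A, B, hA, hB, hAB, hsub, hcover⟩ := exists_separation_of_not_conn hne hX hY hXY
    refine ⟨∅, A, B, hA, hB, hAB, by simp, hsub, by simpa using hcover, fun Z _ _ => ?_⟩
    obtain ⟨F, hF, hFZ⟩ := hnt.exists_ne Z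
    exact ⟨F, hF, hFZ, Set.empty_subset F⟩

/-- An edge is an ear of a family if its intersection with the union of the other edges is contained
in one of these. -/
def IsEar (𝓔 : Set (Set α)) (E : Set α) : Prop :=
  E ∈ 𝓔 ∧ ∃ F ∈ 𝓔, F ≠ E ∧ ∀ E' ∈ 𝓔, E' ≠ E → E ∩ E' ⊆ F

/-- In a reduced acyclic family with at least two edges, there is an ear different from any
prescribed edge. -/
theorem ReducedAcyclic.exists_isEar_ne [Finite α] (h : ReducedAcyclic 𝓔)
    (hanti : IsAntichain (· ⊆ ·) 𝓔) (hne : ∀ X ∈ 𝓔, X.Nonempty) (hnt : 𝓔.Nontrivial)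
    (hX : X ∈ 𝓔) : ∃ E, IsEar 𝓔 E ∧ E ≠ X := by
  induction hn : (⋃₀ 𝓔).ncard using Nat.strong_induction_on generalizing 𝓔 X with
  | _ n ih =>
  obtain ⟨S, A, B, hA, hB, hAB, hS, hsub, hcover, hwit⟩ := h.exists_separator hanti hne hnt
  wlog hXA : Disjoint X A generalizing A B with H
  · refine H B A hB hA hAB.symm (by rwa [Set.union_comm]) (by rwa [Set.union_comm])
      (fun Z hZ => (hcover Z hZ).symm) ?_
    rw [Set.not_disjoint_iff] at hXA
    obtain ⟨a, haX, haA⟩ := hXA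
    rw [Set.disjoint_union_right] at hS
    rcases hcover X hX with hsub | hsub
    · exact Set.disjoint_of_subset_left hsub (Set.disjoint_union_left.2 ⟨hAB, hS.2⟩)
    · rcases hsub haX with ha | ha
      · exact (Set.disjoint_left.1 hAB haA ha).elim
      · exact (Set.disjoint_left.1 hS.1 ha haA).elim
  rw [Set.disjoint_union_right] at hS
  have hmeet : ∀ Z ∈ 𝓔, (Z ∩ A).Nonempty → Z ⊆ A ∪ S := by
    rintro Z hZ ⟨a, haZ, haA⟩
    rcases hcover Z hZ with h | h
    · exact h
    · rcases h haZ with ha | ha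
      · exact (Set.disjoint_left.1 hAB haA ha).elim
      · exact (Set.disjoint_left.1 hS.1 ha haA).elim
  have hmiss : ∀ Z : Set α, ¬ (Z ∩ A).Nonempty → Z ∩ (A ∪ S) ⊆ S := by
    rintro Z hZ a ⟨haZ, haA | haS⟩
    · exact (hZ ⟨a, haZ, haA⟩).elim
    · exact haS
  obtain ⟨a, haA⟩ := hA
  obtain ⟨E₀, hE₀, haE₀⟩ := hsub (.inl haA)
  obtain ⟨F₀, hF₀, -, hSF₀⟩ := hwit E₀ hE₀
    fun hss => Set.disjoint_left.1 hS.1 (hss haE₀) haA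
  have hD : ∃ D ∈ PartialEdges 𝓔 (A ∪ S), S ⊆ D := by
    rcases S.eq_empty_or_nonempty with rfl | hSne
    · obtain ⟨D, hD, -⟩ := exists_subset_mem_partialEdges (M := A ∪ ∅) hE₀ ⟨a, haE₀, .inl haA⟩
      exact ⟨D, hD, Set.empty_subset D⟩
    · have hSF : S ⊆ F₀ ∩ (A ∪ S) := Set.subset_inter hSF₀ Set.subset_union_right
      obtain ⟨D, hD, hFD⟩ := exists_subset_mem_partialEdges hF₀ (hSne.mono hSF)
      exact ⟨D, hD, hSF.trans hFD⟩
  obtain ⟨D, hD, hSD⟩ := hD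
  have hmem : ∀ Z ∈ 𝓔, (Z ∩ A).Nonempty → Z ∈ PartialEdges 𝓔 (A ∪ S) := by
    intro Z hZ hZA
    have hZM := hmeet Z hZ hZA
    obtain ⟨G, hG, hZG⟩ := exists_subset_mem_partialEdges (M := A ∪ S) hZ
      (hZA.mono (Set.inter_subset_inter_right Z Set.subset_union_left))
    obtain ⟨G, hG', rfl⟩ := exists_eq_inter_of_mem_partialEdges hG
    rw [Set.inter_eq_left.2 hZM] at hZG
    obtain rfl := hanti.eq hZ hG' (hZG.trans Set.inter_subset_left)
    rwa [Set.inter_eq_left.2 hZM] at hG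
  by_cases hnt' : (PartialEdges 𝓔 (A ∪ S)).Nontrivial
  · have hlt : (⋃₀ PartialEdges 𝓔 (A ∪ S)).ncard < n := by
      rw [← hn]
      refine Set.ncard_lt_ncard ((Set.ssubset_iff_of_subset ?_).2 ?_)
      · rintro b ⟨_, hZ, hb⟩
        obtain ⟨Z, hZ', rfl⟩ := exists_eq_inter_of_mem_partialEdges hZ
        exact ⟨Z, hZ', hb.1⟩
      · obtain ⟨b, hb⟩ := hB
        refine ⟨b, hsub (.inr hb), ?_⟩
        rintro ⟨_, hZ, hbZ⟩
        obtain ⟨Z, hZ, rfl⟩ := exists_eq_inter_of_mem_partialEdges hZ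
        rcases hbZ.2 with hbA | hbS
        · exact Set.disjoint_left.1 hAB hbA hb
        · exact Set.disjoint_left.1 hS.2 hbS hb
    obtain ⟨E, ⟨hE, F, hF, hFE, hEF⟩, hED⟩ := ih _ hlt (h.partialEdges _) (isAntichain_reduction _)
      (fun Z hZ => nonempty_of_mem_partialEdges hZ) hnt' hD rfl
    obtain ⟨E, hE', rfl⟩ := exists_eq_inter_of_mem_partialEdges hE
    have hEA : (E ∩ A).Nonempty := by
      by_contra hEA
      exact hED (isAntichain_reduction _ |>.eq hE hD ((hmiss E hEA).trans hSD))
    have hEM := hmeet E hE' hEA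
    rw [Set.inter_eq_left.2 hEM] at *
    obtain ⟨F, hF', rfl⟩ := exists_eq_inter_of_mem_partialEdges hF
    refine ⟨E, ⟨hE', F, hF', ?_, fun E' hE'' hne' => ?_⟩, ?_⟩
    · rintro rfl
      exact hFE (Set.inter_eq_left.2 hEM)
    · refine Set.Subset.trans ?_ (Set.inter_subset_left (t := A ∪ S))
      by_cases hA' : (E' ∩ A).Nonempty
      · exact hEF E' (hmem E' hE'' hA') hne'
      · refine Set.Subset.trans ?_ (hEF D hD hED.symm)
        exact fun b hb => ⟨hb.1, hSD (hmiss E' hA' ⟨hb.2, hEM hb.1⟩)⟩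
    · rintro rfl
      exact Set.not_disjoint_iff_nonempty_inter.2 hEA hXA
  · rw [Set.not_nontrivial_iff] at hnt'
    have hE₀A : (E₀ ∩ A).Nonempty := ⟨a, haE₀, haA⟩
    obtain ⟨F, hF, hFE, hSF⟩ := hwit E₀ hE₀
      fun hss => Set.disjoint_left.1 hS.1 (hss haE₀) haA
    refine ⟨E₀, ⟨hE₀, F, hF, hFE, fun E' hE' hne' => ?_⟩, ?_⟩
    · have hA' : ¬ (E' ∩ A).Nonempty := fun hA' =>
        hne' (hnt' (hmem E' hE' hA') (hmem E₀ hE₀ hE₀A))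
      exact fun b hb => hSF (hmiss E' hA' ⟨hb.2, hmeet E₀ hE₀ hE₀A hb.1⟩)
    · rintro rfl
      exact Set.not_disjoint_iff_nonempty_inter.2 hE₀A hXA

/-- Every acyclic family with at least two members has a member whose intersections with the other
members are all contained in one of the other members. -/
theorem Acyclic.exists_ear_index [Finite α] [Nontrivial ι] {E : ι → Set α}
    (h : Acyclic (Set.range E)) (hne : ∀ i, (E i).Nonempty) :
    ∃ i j, j ≠ i ∧ ∀ k, k ≠ i → E i ∩ E k ⊆ E j := by
  by_cases hex : ∃ i j, j ≠ i ∧ E i ⊆ E j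
  · obtain ⟨i, j, hji, hij⟩ := hex
    exact ⟨i, j, hji, fun k _ => Set.inter_subset_left.trans hij⟩
  · push Not at hex
    have hinj : Function.Injective E := fun i j hij => by
      by_contra hne'
      exact hex i j (Ne.symm hne') hij.subset
    have hanti : IsAntichain (· ⊆ ·) (Set.range E) := by
      rintro _ ⟨i, rfl⟩ _ ⟨j, rfl⟩ hij hsub
      exact hex i j (fun hji => hij (hji ▸ rfl)) hsub
    have hnt : (Set.range E).Nontrivial := by
      obtain ⟨i, j, hij⟩ := exists_pair_ne ι
      exact ⟨E i, ⟨i, rfl⟩, E j, ⟨j, rfl⟩, hinj.ne hij⟩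
    obtain ⟨_, hX, -⟩ := id hnt
    obtain ⟨_, ⟨⟨i, rfl⟩, _, ⟨j, rfl⟩, hji, hear⟩, -⟩ := (acyclic_iff.1 h).exists_isEar_ne hanti
      (by rintro _ ⟨i, rfl⟩; exact hne i) hnt hX
    exact ⟨i, j, fun hj => hji (hj ▸ rfl), fun k hk => hear _ ⟨k, rfl⟩ (hinj.ne hk)⟩

/-- Deleting an ear from an acyclic family yields an acyclic family. -/
theorem Acyclic.delete_ear [Finite α] {E : ι → Set α} (h : Acyclic (Set.range E))
    (hne : ∀ i, (E i).Nonempty) {i j : ι} (hji : j ≠ i) (hear : ∀ k, k ≠ i → E i ∩ E k ⊆ E j) :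
    Acyclic (Set.range fun k : {k // k ≠ i} => E k) := by
  have key : Reduction (Set.range fun k : {k // k ≠ i} => E k) =
      PartialEdges (Set.range E) (⋃ k : {k // k ≠ i}, E k) := by
    have hk : ∀ k : {k // k ≠ i}, E k ∩ (⋃ k : {k // k ≠ i}, E k) = E k := fun k =>
      Set.inter_eq_left.2 (Set.subset_iUnion (fun k : {k // k ≠ i} => E k) k)
    refine reduction_congr ?_ ?_
    · rintro _ ⟨k, rfl⟩
      exact ⟨E k, ⟨⟨E k, ⟨k, rfl⟩, (hk k).symm⟩, (hne k).ne_empty⟩, subset_rfl⟩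
    · rintro _ ⟨⟨_, ⟨k, rfl⟩, rfl⟩, -⟩
      by_cases hki : k = i
      · subst hki
        refine ⟨E j, ⟨⟨j, hji⟩, rfl⟩, ?_⟩
        rw [Set.inter_iUnion]
        exact Set.iUnion_subset fun l => hear l l.2
      · exact ⟨E k, ⟨⟨k, hki⟩, rfl⟩, Set.inter_subset_left⟩
  rw [Acyclic, key]
  exact (acyclic_iff.1 h).partialEdges _

end HyperAcyclic

section JoinTree

open SimpleGraph

variable {α ι : Type*} {E : ι → Set α}

theorem IsJoinTree.of_walks {T : SimpleGraph ι} (hT : T.IsTree)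
    (h : ∀ i j a, a ∈ E i → a ∈ E j → ∃ p : T.Walk i j, ∀ k ∈ p.support, a ∈ E k) :
    IsJoinTree T E := by
  classical
  refine ⟨hT, fun i j a hi hj p hp k hk => ?_⟩
  obtain ⟨q, hq⟩ := h i j a hi hj
  obtain rfl : p = q.bypass := (hT.existsUnique_path i j).unique hp q.bypass_isPath
  exact hq k (q.support_bypass_subset_support hk)

/-- A tree stays a tree when a new leaf is attached to it. -/
theorem SimpleGraph.IsTree.map_sup_edge [Finite ι] {i j : ι} (hji : j ≠ i)
    {T : SimpleGraph {k // k ≠ i}} (hT : T.IsTree) :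
    (T.map (Function.Embedding.subtype _) ⊔ edge i j).IsTree := by
  set G := T.map (Function.Embedding.subtype (· ≠ i)) ⊔ edge i j with hG
  have hadj : G.Adj i j := by simp [hG, edge_adj, hji.symm]
  let f : T →g G :=
    ⟨Subtype.val, fun h => .inl ((Embedding.map (Function.Embedding.subtype _) T).map_rel_iff.2 h)⟩
  have hreach : ∀ k, G.Reachable j k := by
    intro k
    by_cases hk : k = i
    · exact hk ▸ hadj.symm.reachable
    · obtain ⟨p⟩ := hT.connected.preconnected ⟨j, hji⟩ ⟨k, hk⟩
      exact (p.map f).reachable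
  have hconn : G.Connected :=
    connected_iff _ |>.2 ⟨fun u v => (hreach u).symm.trans (hreach v), ⟨j⟩⟩
  refine isTree_iff_connected_and_card.2 ⟨hconn, le_antisymm ?_
    hconn.card_vert_le_card_edgeSet_add_one⟩
  have hcardT := (isTree_iff_connected_and_card.1 hT).2
  have hcard : Nat.card {k // k ≠ i} + 1 = Nat.card ι := by
    have := Set.ncard_add_ncard_compl ({i} : Set ι)
    rw [Set.ncard_singleton, add_comm] at this
    exact this
  have hle : G.edgeSet.ncard ≤ T.edgeSet.ncard + 1 := by
    rw [hG, edgeSet_sup, edgeSet_map, edgeSet_edge_of_ne hji.symm]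
    refine (Set.ncard_union_le _ _).trans ?_
    rw [Set.ncard_singleton]
    exact Nat.add_le_add_right (Set.ncard_image_le (Set.toFinite _)) 1
  rw [Nat.card_coe_set_eq] at hcardT ⊢
  lia

/-- A join tree of a family without an ear extends to a join tree of the whole family. -/
theorem IsJoinTree.map_sup_edge [Finite ι] {i j : ι} (hji : j ≠ i)
    (hear : ∀ k, k ≠ i → E i ∩ E k ⊆ E j) {T : SimpleGraph {k // k ≠ i}}
    (hT : IsJoinTree T fun k => E k) :
    IsJoinTree (T.map (Function.Embedding.subtype _) ⊔ edge i j) E := by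
  set G := T.map (Function.Embedding.subtype (· ≠ i)) ⊔ edge i j with hG
  have hadj : G.Adj i j := by simp [hG, edge_adj, hji.symm]
  let f : T →g G :=
    ⟨Subtype.val, fun h => .inl ((Embedding.map (Function.Embedding.subtype _) T).map_rel_iff.2 h)⟩
  have hold : ∀ k l a, k ≠ i → l ≠ i → a ∈ E k → a ∈ E l →
      ∃ p : G.Walk k l, ∀ u ∈ p.support, a ∈ E u := by
    intro k l a hk hl hak hal
    obtain ⟨p, hp⟩ := (hT.1.existsUnique_path ⟨k, hk⟩ ⟨l, hl⟩).exists
    refine ⟨p.map f, fun u hu => ?_⟩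
    rw [Walk.support_map, List.mem_map] at hu
    obtain ⟨v, hv, rfl⟩ := hu
    exact hT.2 _ _ a hak hal p hp v hv
  have hnew : ∀ k a, a ∈ E i → a ∈ E k → ∃ p : G.Walk i k, ∀ u ∈ p.support, a ∈ E u := by
    intro k a hai hak
    by_cases hk : k = i
    · subst hk
      exact ⟨.nil, by simpa using hai⟩
    · obtain ⟨p, hp⟩ := hold j k a hji hk (hear k hk ⟨hai, hak⟩) hak
      exact ⟨.cons hadj p, by simpa using ⟨hai, hp⟩⟩
  refine .of_walks (hT.1.map_sup_edge hji) fun k l a hak hal => ?_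
  by_cases hk : k = i
  · subst hk
    exact hnew l a hak hal
  · by_cases hl : l = i
    · subst hl
      obtain ⟨p, hp⟩ := hnew k a hal hak
      exact ⟨p.reverse, by simpa using hp⟩
    · exact hold k l a hk hl hak hal

theorem HyperAcyclic.Acyclic.exists_isJoinTree [Finite α] [Finite ι] [Nonempty ι]
    (h : Acyclic (Set.range E)) (hne : ∀ i, (E i).Nonempty) :
    ∃ T : SimpleGraph ι, IsJoinTree T E := by
  induction hn : Nat.card ι using Nat.strong_induction_on generalizing ι with
  | _ n ih =>
  rcases subsingleton_or_nontrivial ι with hι | hι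
  · refine ⟨⊥, .of_walks .of_subsingleton fun i j a hi _ => ?_⟩
    obtain rfl := Subsingleton.elim i j
    exact ⟨.nil, by simpa using hi⟩
  · obtain ⟨i, j, hji, hear⟩ := h.exists_ear_index hne
    have : Nonempty {k // k ≠ i} := ⟨⟨j, hji⟩⟩
    have hlt : Nat.card {k // k ≠ i} < n :=
      hn ▸ Finite.card_subtype_lt (x := i) (by simp)
    obtain ⟨T, hT⟩ := ih _ hlt (h.delete_ear hne hji hear) (fun k => hne k) rfl
    exact ⟨_, hT.map_sup_edge hji hear⟩

/-- In a join tree of a family, an edge `uv` separates the members on its two sides by the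
intersection of the members at `u` and `v`. -/
theorem IsJoinTree.reachable_deleteEdges {T : SimpleGraph ι} (hT : IsJoinTree T E) {u v k l : ι}
    {a : α} (hk : a ∈ E k) (hl : a ∈ E l) (ha : a ∉ E u ∩ E v) :
    (T.deleteEdges {s(u, v)}).Reachable k l := by
  obtain ⟨p, hp⟩ := (hT.1.existsUnique_path k l).exists
  refine ⟨p.toDeleteEdge s(u, v) fun he => ha ⟨?_, ?_⟩⟩
  · exact hT.2 k l a hk hl p hp u (p.fst_mem_support_of_mem_edges he)
  · exact hT.2 k l a hk hl p hp v (p.snd_mem_support_of_mem_edges he)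

theorem SimpleGraph.IsTree.not_reachable_deleteEdges {T : SimpleGraph ι} (hT : T.IsTree) {i j : ι}
    {p : T.Walk i j} (hp : p.IsPath) {e : Sym2 ι} (he : e ∈ p.edges) :
    ¬ (T.deleteEdges {e}).Reachable i j := by
  classical
  rintro ⟨q⟩
  have hle : T.deleteEdges {e} ≤ T := deleteEdges_le _
  obtain rfl : p = (q.mapLe hle).bypass :=
    (hT.existsUnique_path i j).unique hp (Walk.bypass_isPath _)
  have := Walk.edges_bypass_subset_edges _ he
  rw [Walk.edges_mapLe_eq_edges] at this
  simpa using q.edges_subset_edgeSet this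

theorem IsJoinTree.hasArticulationSet_partialEdges [Finite α] {T : SimpleGraph ι}
    (hT : IsJoinTree T E) {M : Set α}
    (hconn : HyperAcyclic.IsConnectedSet (HyperAcyclic.PartialEdges (Set.range E) M))
    (hnt : (HyperAcyclic.PartialEdges (Set.range E) M).Nontrivial) :
    HyperAcyclic.HasArticulationSet (HyperAcyclic.PartialEdges (Set.range E) M) := by
  set 𝓕 := HyperAcyclic.PartialEdges (Set.range E) M
  obtain ⟨⟨X, Y⟩, ⟨hX, hY, hXY⟩, hmax⟩ := Set.exists_max_image
    {p : Set α × Set α | p.1 ∈ 𝓕 ∧ p.2 ∈ 𝓕 ∧ p.1 ≠ p.2} (fun p => (p.1 ∩ p.2).ncard)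
    (Set.toFinite _) (by
      obtain ⟨X, hX, Y, hY, hXY⟩ := hnt
      exact ⟨(X, Y), hX, hY, hXY⟩)
  dsimp only at hX hY hXY hmax
  have hZ : ∀ k, ∃ Z ∈ 𝓕, E k ∩ M ⊆ Z := by
    intro k
    by_cases hk : (E k ∩ M).Nonempty
    · exact HyperAcyclic.exists_subset_mem_partialEdges ⟨k, rfl⟩ hk
    · exact ⟨X, hX, by simp [Set.not_nonempty_iff_eq_empty.1 hk]⟩
  choose Z hZ𝓕 hZ using hZ
  have hanti : IsAntichain (· ⊆ ·) 𝓕 := HyperAcyclic.isAntichain_reduction _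
  obtain ⟨_, ⟨i, rfl⟩, hXi⟩ := HyperAcyclic.exists_eq_inter_of_mem_partialEdges hX
  obtain ⟨_, ⟨j, rfl⟩, hYj⟩ := HyperAcyclic.exists_eq_inter_of_mem_partialEdges hY
  have hZi : X = Z i := hanti.eq hX (hZ𝓕 i) (hXi ▸ hZ i)
  have hZj : Y = Z j := hanti.eq hY (hZ𝓕 j) (hYj ▸ hZ j)
  obtain ⟨p, hp⟩ := (hT.1.existsUnique_path i j).exists
  obtain ⟨d, hd, hdu, hdv⟩ := p.exists_boundary_dart {k | Z k = X} hZi.symm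
    (fun hj => hXY (hj.symm.trans hZj.symm))
  have hu := p.dart_fst_mem_support_of_mem_darts hd
  have hv := p.dart_snd_mem_support_of_mem_darts hd
  have hsub : X ∩ Y ⊆ (E d.fst ∩ E d.snd) ∩ M := by
    rintro a ⟨haX, haY⟩
    rw [hXi] at haX
    rw [hYj] at haY
    exact ⟨⟨hT.2 i j a haX.1 haY.1 p hp _ hu, hT.2 i j a haX.1 haY.1 p hp _ hv⟩, haX.2⟩
  have hsub' : (E d.fst ∩ E d.snd) ∩ M ⊆ Z d.fst ∩ Z d.snd := fun a ha =>
    ⟨hZ _ ⟨ha.1.1, ha.2⟩, hZ _ ⟨ha.1.2, ha.2⟩⟩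
  have hne : Z d.fst ≠ Z d.snd := fun h => hdv (h.symm.trans hdu)
  have hS : X ∩ Y = Z d.fst ∩ Z d.snd := Set.eq_of_subset_of_ncard_le (hsub.trans hsub')
    (hmax (Z d.fst, Z d.snd) ⟨hZ𝓕 _, hZ𝓕 _, hne⟩)
  have hsep : ∀ {k l a}, a ∈ E k ∩ M → a ∈ E l → a ∉ X ∩ Y →
      (T.deleteEdges {s(d.fst, d.snd)}).Reachable k l := fun {k l a} hk hl ha =>
    hT.reachable_deleteEdges hk.1 hl fun h => ha (hS ▸ hsub' ⟨h, hk.2⟩)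
  have hXne : (X \ (X ∩ Y)).Nonempty := by
    rw [Set.sdiff_self_inter]
    exact Set.sdiff_nonempty.2 fun h => hXY (hanti.eq hX hY h)
  have hYne : (Y \ (X ∩ Y)).Nonempty := by
    rw [Set.sdiff_inter_self_eq_sdiff]
    exact Set.sdiff_nonempty.2 fun h => hXY (hanti.eq hY hX h).symm
  refine ⟨X, hX, Y, hY, (HyperAcyclic.numComponents_le_one hconn).trans_lt
    (HyperAcyclic.one_lt_numComponents (X := X \ (X ∩ Y)) (Y := Y \ (X ∩ Y))
      ⟨⟨X, hX, rfl⟩, hXne.ne_empty⟩ ⟨⟨Y, hY, rfl⟩, hYne.ne_empty⟩ ?_)⟩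
  rintro ⟨-, hchain⟩
  have hside : ∀ W, Relation.ReflTransGen (fun U W => W ∈ ({Z | ∃ W ∈ 𝓕, Z = W \ (X ∩ Y)} \ {∅} :
      Set (Set α)) ∧ (U ∩ W).Nonempty) (X \ (X ∩ Y)) W → ∀ a ∈ W, ∀ l, a ∈ E l →
      (T.deleteEdges {s(d.fst, d.snd)}).Reachable i l := by
    intro W hW
    induction hW with
    | refl =>
      rintro a ⟨haX, ha⟩ l hal
      exact hsep (hXi ▸ haX) hal ha
    | tail _ hstep ih =>
      obtain ⟨⟨⟨W, hW, rfl⟩, -⟩, b, hbU, hbW⟩ := hstep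
      obtain ⟨_, ⟨k, rfl⟩, rfl⟩ := HyperAcyclic.exists_eq_inter_of_mem_partialEdges hW
      intro a ha l hal
      exact (ih b hbU k hbW.1.1).trans (hsep ha.1 hal ha.2)
  obtain ⟨a, ha⟩ := hYne
  refine hT.1.not_reachable_deleteEdges hp (List.mem_map_of_mem hd)
    (hside _ hchain a ha j ?_)
  exact (hYj ▸ ha.1 : a ∈ E j ∩ M).1

theorem IsJoinTree.acyclic [Finite α] {T : SimpleGraph ι} (hT : IsJoinTree T E) :
    HyperAcyclic.Acyclic (Set.range E) := by
  rw [HyperAcyclic.acyclic_iff]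
  intro M hconn hart
  by_contra hcard
  exact hart (hT.hasArticulationSet_partialEdges hconn
    (Set.one_lt_ncard_iff_nontrivial.1 (not_lt.1 hcard)))

end JoinTree

/-- a nonempty finite hypergraph with nonempty hyperedges `E i` covering
the vertex set is acyclic iff the family `(E i)` has a join tree. -/
theorem acyclic_iff_joinTree (m n : ℕ) (hm : 0 < m)
    (E : Fin m → Set (Fin n))
    (hne : ∀ i, (E i).Nonempty) (hU : (⋃ i, E i) = Set.univ) :
    HyperAcyclic.Acyclic (Set.range E) ↔
      ∃ T : SimpleGraph (Fin m), IsJoinTree T E := by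
  have : Nonempty (Fin m) := ⟨⟨0, hm⟩⟩
  exact ⟨fun h => h.exists_isJoinTree hne, fun ⟨_, hT⟩ => hT.acyclic⟩
end

section
/- Let S be a finite collection of finite nonempty sets with U(S) = ⋃_{s∈S} s nonempty. There exists a forest F (an acyclic simple graph) with vertex set U(S) such that every s ∈ S induces a connected subgraph of F if and only if there exists a tree T (a connected acyclic simple graph) with vertex set U(S) such that every s ∈ S induces a connected subgraph of T. -/
/-- a collection `S_1, …, S_m` of nonempty sets covering the nonempty
vertex set `U(S)` (modeled as `Fin n`, `0 < n`) is tree convex with respect to some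
forest (acyclic simple graph) on `U(S)` iff it is tree convex with respect to some
tree (connected acyclic simple graph) on `U(S)`. -/
theorem forestConvex_iff_treeConvex (m n : ℕ) (hn : 0 < n)
    (S : Fin m → Set (Fin n))
    (hne : ∀ j, (S j).Nonempty) (hU : (⋃ j, S j) = Set.univ) :
    (∃ F : SimpleGraph (Fin n), F.IsAcyclic ∧ ∀ j, (F.induce (S j)).Connected) ↔
      (∃ T : SimpleGraph (Fin n), T.IsTree ∧ ∀ j, (T.induce (S j)).Connected) := by
  constructor
  · rintro ⟨F, hF, hS⟩
    obtain ⟨T, hFT, hT⟩ := (Set.toFinite {G : SimpleGraph (Fin n) | G.IsAcyclic}).exists_le_maximal hF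
    exact ⟨T, SimpleGraph.isTree_iff_maximal_isAcyclic.mpr ⟨⟨⟨0, hn⟩⟩, hT⟩,
      fun j ↦ (hS j).mono (SimpleGraph.comap_monotone _ hFT)⟩
  · rintro ⟨T, hT, hS⟩
    exact ⟨T, hT.isAcyclic, hS⟩
end

section
/- Let S = {S_1, …, S_m} be a finite collection of finite nonempty sets with U = ⋃_{s∈S} s, and let G be the edge-weighted simple graph with vertex set U having an edge {a, b} between distinct a, b exactly when some s ∈ S contains both a and b, with weight w({a,b}) = |{s ∈ S : a, b ∈ s}|. Assume G is connected, and let T be any spanning tree of G whose total edge weight is maximum among all spanning trees of G. Then S is tree convex if and only if every s ∈ S induces a connected subgraph of T. -/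
namespace SimpleGraph

theorem IsAcyclic.card_edgeSet_add_one_le {V : Type*} [Finite V] [Nonempty V] {G : SimpleGraph V}
    (hG : G.IsAcyclic) :
    Nat.card G.edgeSet + 1 ≤ Nat.card V := by
  obtain ⟨F, hGF, -, hF⟩ :=
    (connected_top (V := V)).exists_isTree_le_of_le_of_isAcyclic le_top hG
  rw [← (isTree_iff_connected_and_card.1 hF).2]
  exact Nat.add_le_add_right (Nat.card_mono (Set.toFinite _) (edgeSet_mono hGF)) 1

theorem IsAcyclic.isTree_of_card_le {V : Type*} [Finite V] [Nonempty V] {G : SimpleGraph V}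
    (hG : G.IsAcyclic)
    (hcard : Nat.card V ≤ Nat.card G.edgeSet + 1) : G.IsTree := by
  obtain ⟨F, hGF, -, hF⟩ :=
    (connected_top (V := V)).exists_isTree_le_of_le_of_isAcyclic le_top hG
  rw [← (isTree_iff_connected_and_card.1 hF).2, Nat.add_le_add_iff_right] at hcard
  have heq : G.edgeSet = F.edgeSet :=
    Set.eq_of_subset_of_ncard_le (edgeSet_mono hGF) hcard (Set.toFinite _)
  rwa [edgeSet_injective heq]

theorem card_edgeSet_induce {V : Type*} (G : SimpleGraph V) (s : Set V) :
    Nat.card (G.induce s).edgeSet = {e ∈ G.edgeSet | ∀ a ∈ e, a ∈ s}.ncard := by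
  have himage : Sym2.map Subtype.val '' (G.induce s).edgeSet =
      {e ∈ G.edgeSet | ∀ a ∈ e, a ∈ s} := by
    ext e
    induction e with | _ a b
    constructor
    · rintro ⟨e, he, heq⟩
      rw [← heq]
      induction e with | _ x y
      simpa using he
    · rintro ⟨hab, hs⟩
      exact ⟨s(⟨a, hs a (by simp)⟩, ⟨b, hs b (by simp)⟩), by simpa using hab, by simp⟩
  rw [← himage, Set.ncard_image_of_injective _ (Sym2.map.injective Subtype.val_injective)]
  rfl

theorem sum_ncard_eq_sum_card_edgeSet_induce {V ι : Type*} [Finite V] [Fintype ι]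
    (G : SimpleGraph V) (S : ι → Set V) :
    ∑ e ∈ G.edgeSet.toFinite.toFinset, {j | ∀ a ∈ e, a ∈ S j}.ncard =
      ∑ j, Nat.card (G.induce (S j)).edgeSet := by
  classical
  simp_rw [card_edgeSet_induce]
  convert Finset.sum_card_bipartiteAbove_eq_sum_card_bipartiteBelow
    (s := G.edgeSet.toFinite.toFinset) (t := Finset.univ) (fun e j ↦ ∀ a ∈ e, a ∈ S j) using 2
  · rw [← Set.ncard_coe_finset]
    simp [Finset.bipartiteAbove]
  · rw [← Set.ncard_coe_finset]
    simp [Finset.bipartiteBelow]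

theorem induce_inf_of_isClique {V : Type*} {G : SimpleGraph V} {s : Set V}
    (H : SimpleGraph V) (hs : G.IsClique s) :
    (H ⊓ G).induce s = H.induce s := by
  ext a b
  exact ⟨fun h ↦ h.1, fun h ↦ ⟨h, hs a.2 b.2 (SimpleGraph.Adj.ne (G := H) h)⟩⟩

/-- Replacing each edge of a connected graph by a path keeps the graph connected. -/
theorem Connected.of_forall_adj_reachable {V : Type*} {G H : SimpleGraph V} (hG : G.Connected)
    (h : ∀ a b, G.Adj a b → H.Reachable a b) : H.Connected := by
  have := hG.nonempty
  refine ⟨fun a b ↦ ?_⟩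
  obtain ⟨p⟩ := hG.preconnected a b
  induction p with
  | nil => rfl
  | cons hadj _ ih => exact (h _ _ hadj).trans ih

end SimpleGraph

/-- let `G` be the weighted graph on the vertices `U = U(S)` (modeled as
`Fin n`) joining distinct `a, b` exactly when some `S j` contains both, with weight
`w({a,b}) = |{j | a ∈ S j ∧ b ∈ S j}|`.  If `G` is connected and `T` is a maximum
spanning tree of `G`, then `S` is tree convex iff every `S j` induces a connected
subgraph of `T`. -/
theorem treeConvex_iff_maxSpanningTree (m n : ℕ) (S : Fin m → Set (Fin n))
    (hne : ∀ j, (S j).Nonempty) (hU : (⋃ j, S j) = Set.univ)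
    (G : SimpleGraph (Fin n))
    (hG : ∀ a b, G.Adj a b ↔ a ≠ b ∧ ∃ j, a ∈ S j ∧ b ∈ S j)
    (w : Sym2 (Fin n) → ℕ)
    (hw : ∀ e : Sym2 (Fin n), w e = {j : Fin m | ∀ a ∈ e, a ∈ S j}.ncard)
    (hGconn : G.Connected)
    (T : SimpleGraph (Fin n)) (hTsub : T ≤ G) (hTtree : T.IsTree)
    (hTmax : ∀ T' : SimpleGraph (Fin n), T' ≤ G → T'.IsTree →
      ∑ e ∈ T'.edgeSet.toFinite.toFinset, w e ≤ ∑ e ∈ T.edgeSet.toFinite.toFinset, w e) :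
    (∃ T'' : SimpleGraph (Fin n), T''.IsTree ∧ ∀ j, (T''.induce (S j)).Connected) ↔
      ∀ j, (T.induce (S j)).Connected := by
  refine ⟨?_, fun h ↦ ⟨T, hTtree, h⟩⟩
  rintro ⟨T₀, hT₀, hconn⟩
  have hclique (j) : G.IsClique (S j) := fun a ha b hb hab ↦ (hG a b).2 ⟨hab, j, ha, hb⟩
  have hconn' (j) : ((T₀ ⊓ G).induce (S j)).Connected := by
    rw [SimpleGraph.induce_inf_of_isClique T₀ (hclique j)]
    exact hconn j
  have htree : (T₀ ⊓ G).IsTree := by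
    refine ⟨hGconn.of_forall_adj_reachable fun a b hab ↦ ?_, hT₀.isAcyclic.anti inf_le_left⟩
    obtain ⟨-, j, ha, hb⟩ := (hG a b).1 hab
    exact ((hconn' j).preconnected ⟨a, ha⟩ ⟨b, hb⟩).map
      (SimpleGraph.Embedding.induce (S j)).toHom
  have hnonempty (j) : Nonempty (S j) := (hne j).to_subtype
  have hle (j) : Nat.card (T.induce (S j)).edgeSet ≤
      Nat.card ((T₀ ⊓ G).induce (S j)).edgeSet := by
    have h₁ := (hTtree.isAcyclic.induce (S j)).card_edgeSet_add_one_le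
    have h₂ := (SimpleGraph.isTree_iff_connected_and_card.1
      ⟨hconn' j, htree.isAcyclic.induce (S j)⟩).2
    lia
  have hmax := hTmax _ inf_le_right htree
  simp_rw [hw, SimpleGraph.sum_ncard_eq_sum_card_edgeSet_induce] at hmax
  have heq := (Finset.sum_eq_sum_iff_of_le fun j _ ↦ hle j).1
    ((Finset.sum_le_sum fun j _ ↦ hle j).antisymm hmax)
  intro j
  refine ((hTtree.isAcyclic.induce (S j)).isTree_of_card_le ?_).connected
  rw [heq j (Finset.mem_univ j)]
  exact (SimpleGraph.isTree_iff_connected_and_card.1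
    ⟨hconn' j, htree.isAcyclic.induce (S j)⟩).2.ge
end

section
/- Consider a binary constraint network with a finite set of variables V, a finite nonempty domain D_x for each x ∈ V, and for each ordered pair of distinct variables (x, y) a constraint c_{xy} ⊆ D_x × D_y with c_{yx} equal to the inverse relation of c_{xy}. Suppose the network is tree convex, arc consistent, and path consistent. Then the network is globally consistent: every partial assignment defined on a subset W ⊆ V that satisfies c_{xy} for all distinct x, y ∈ W extends to an assignment on all of V that satisfies c_{xy} for all distinct x, y ∈ V. -/
namespace SimpleGraph

variable {α : Type*} {G : SimpleGraph α}

/-- A set of vertices is path convex if it contains every path between two of its members. -/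
def IsPathConvex (G : SimpleGraph α) (S : Set α) : Prop :=
  ∀ ⦃u v : α⦄, u ∈ S → v ∈ S → ∀ p : G.Walk u v, p.IsPath → ∀ w ∈ p.support, w ∈ S

theorem IsPathConvex.inter {S T : Set α} (hS : G.IsPathConvex S) (hT : G.IsPathConvex T) :
    G.IsPathConvex (S ∩ T) := fun _ _ hu hv p hp w hw =>
  ⟨hS hu.1 hv.1 p hp w hw, hT hu.2 hv.2 p hp w hw⟩

/-- In an acyclic graph, the vertices of a path lie on every walk with the same ends. -/
theorem IsAcyclic.support_subset_of_isPath (hG : G.IsAcyclic) {u v : α} {p : G.Walk u v}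
    (hp : p.IsPath) (q : G.Walk u v) : p.support ⊆ q.support := by
  classical
  have h : p = q.bypass :=
    congrArg Subtype.val
      ((hG.subsingleton_path u v).elim ⟨p, hp⟩ ⟨q.bypass, q.bypass_isPath⟩)
  rw [h]
  exact q.support_bypass_subset_support

theorem IsAcyclic.isPathConvex_of_induce_connected (hG : G.IsAcyclic) {S : Set α}
    (hS : (G.induce S).Connected) : G.IsPathConvex S := by
  intro u v hu hv p hp w hw
  obtain ⟨q⟩ := hS.preconnected ⟨u, hu⟩ ⟨v, hv⟩
  have h := hG.support_subset_of_isPath hp (q.map (Embedding.induce S).toHom) hw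
  obtain ⟨x, -, rfl⟩ := List.mem_map.1 (Walk.support_map _ q ▸ h)
  exact x.2

theorem IsTree.inter_inter_nonempty (hG : G.IsTree) {A B C : Set α} (hA : G.IsPathConvex A)
    (hB : G.IsPathConvex B) (hC : G.IsPathConvex C) (hAB : (A ∩ B).Nonempty)
    (hAC : (A ∩ C).Nonempty) (hBC : (B ∩ C).Nonempty) : ((A ∩ B) ∩ C).Nonempty := by
  obtain ⟨c, hcA, hcB⟩ := hAB
  obtain ⟨b, hbA, hbC⟩ := hAC
  obtain ⟨a, haB, haC⟩ := hBC
  obtain ⟨p, hp, -⟩ := hG.existsUnique_path a b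
  obtain ⟨q, hq, -⟩ := hG.existsUnique_path a c
  obtain ⟨r, hr, -⟩ := hG.existsUnique_path c b
  have hpC := hC haC hbC p hp
  have hpAB : ∀ w ∈ p.support, w ∈ A ∨ w ∈ B := by
    intro w hw
    have h := hG.isAcyclic.support_subset_of_isPath hp (q.append r) hw
    rw [Walk.mem_support_append_iff] at h
    exact h.symm.imp (hA hcA hbA r hr w) (hB haB hcB q hq w)
  by_cases hbB : b ∈ B
  · exact ⟨b, ⟨hbA, hbB⟩, hbC⟩
  obtain ⟨d, hd, hdB, hdB'⟩ := p.exists_boundary_dart B haB hbB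
  have hd₁ := p.dart_fst_mem_support_of_mem_darts hd
  have hd₂ := p.dart_snd_mem_support_of_mem_darts hd
  have hdA : d.snd ∈ A := (hpAB _ hd₂).resolve_right hdB'
  obtain ⟨t, ht, -⟩ := hG.existsUnique_path c d.fst
  have htd : d.snd ∉ t.support := fun h => hdB' (hB hcB hdB t ht _ h)
  have hmem : d.fst ∈ (t.concat d.adj).support := by
    rw [Walk.support_concat]
    simp
  exact ⟨d.fst, ⟨hA hcA hdA _ (ht.concat htd d.adj) _ hmem, hdB⟩, hpC _ hd₁⟩

/-- The Helly property of path convex sets in a tree. -/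
theorem IsTree.exists_mem_forall_of_pairwise_inter_nonempty (hG : G.IsTree) {ι : Type*}
    (s : Finset ι) (A : ι → Set α) (hA : ∀ i ∈ s, G.IsPathConvex (A i))
    (hAA : ∀ i ∈ s, ∀ j ∈ s, (A i ∩ A j).Nonempty) : ∃ w, ∀ i ∈ s, w ∈ A i := by
  classical
  induction s using Finset.induction_on generalizing A with
  | empty => exact hG.connected.nonempty.elim fun w => ⟨w, by simp⟩
  | insert a s _ ih =>
    simp only [Finset.forall_mem_insert] at hA hAA
    obtain rfl | ⟨k, hk⟩ := s.eq_empty_or_nonempty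
    · obtain ⟨w, hw, -⟩ := hAA.1.1
      exact ⟨w, by simpa using hw⟩
    obtain ⟨w, hw⟩ := ih (fun i => A i ∩ A a) (fun i hi => (hA.2 i hi).inter hA.1) (by
      intro i hi j hj
      obtain ⟨w, ⟨h₁, h₂⟩, h₃⟩ := hG.inter_inter_nonempty (hA.2 i hi) (hA.2 j hj) hA.1
        ((hAA.2 i hi).2 j hj) (hAA.2 i hi).1 (hAA.2 j hj).1
      exact ⟨w, ⟨h₁, h₃⟩, h₂, h₃⟩)
    exact ⟨w, Finset.forall_mem_insert _ _ _ |>.2 ⟨(hw k hk).2, fun i hi => (hw i hi).1⟩⟩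

end SimpleGraph

/-- a binary constraint network with finite set of variables `V`,
finite nonempty domains `D x`, and constraints `c x y ⊆ D x × D y` (with `c y x` the
inverse of `c x y`) that is tree convex, arc consistent and path consistent is
globally consistent: every partial assignment on a subset `W` of the variables
satisfying all constraints among `W` extends to a total assignment satisfying all
constraints. -/
theorem treeConvex_network_globally_consistent
    {V : Type*} [Fintype V] (D : V → Type*) [∀ x, Fintype (D x)] [∀ x, Nonempty (D x)]
    (c : ∀ x y : V, D x → D y → Prop)
    -- `c y x` is the inverse relation of `c x y`
    (hinv : ∀ x y : V, x ≠ y → ∀ (a : D x) (b : D y), c x y a b ↔ c y x b a)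
    -- tree convexity: for each variable `y` there is a tree on `D y` with respect to
    -- which every nonempty image of a value under a constraint into `y` is a subtree
    (htc : ∀ y : V, ∃ T : SimpleGraph (D y), T.IsTree ∧
      ∀ x : V, x ≠ y → ∀ a : D x, {b : D y | c x y a b}.Nonempty →
        (T.induce {b : D y | c x y a b}).Connected)
    -- arc consistency
    (hac : ∀ x y : V, x ≠ y → ∀ a : D x, ∃ b : D y, c x y a b)
    -- path consistency
    (hpc : ∀ x y z : V, x ≠ y → x ≠ z → y ≠ z → ∀ (a : D x) (b : D y),
      c x y a b → ∃ d : D z, c x z a d ∧ c z y d b)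
    -- a consistent partial assignment on `W`
    (W : Set V) (f : ∀ x ∈ W, D x)
    (hf : ∀ x (hx : x ∈ W), ∀ y (hy : y ∈ W), x ≠ y → c x y (f x hx) (f y hy)) :
    ∃ g : ∀ x : V, D x, (∀ x (hx : x ∈ W), g x = f x hx) ∧
      ∀ x y : V, x ≠ y → c x y (g x) (g y) := by
  classical
  have key : ∀ s : Finset V, ∃ g : ∀ x : V, D x, (∀ x (hx : x ∈ W), g x = f x hx) ∧
      ∀ x y : V, (x ∈ W ∨ x ∈ s) → (y ∈ W ∨ y ∈ s) → x ≠ y → c x y (g x) (g y) := by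
    intro s
    induction s using Finset.induction_on with
    | empty =>
      have hg : ∀ x (hx : x ∈ W),
          (if h : x ∈ W then f x h else Classical.arbitrary (D x)) = f x hx :=
        fun x hx => dif_pos hx
      refine ⟨fun x => if h : x ∈ W then f x h else Classical.arbitrary (D x), hg, ?_⟩
      intro x y hx hy hxy
      replace hx : x ∈ W := by simpa using hx
      replace hy : y ∈ W := by simpa using hy
      simpa only [hg x hx, hg y hy] using hf x hx y hy hxy
    | insert z s _ ih =>
      obtain ⟨g, hgW, hg⟩ := ih
      by_cases hzW : z ∈ W ∨ z ∈ s
      · have hmem : ∀ x, (x ∈ W ∨ x ∈ insert z s) → x ∈ W ∨ x ∈ s := by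
          rintro x (hx | hx)
          · exact Or.inl hx
          · obtain rfl | hx := Finset.mem_insert.1 hx
            exacts [hzW, Or.inr hx]
        exact ⟨g, hgW, fun x y hx hy => hg x y (hmem x hx) (hmem y hy)⟩
      have hne : ∀ x, (x ∈ W ∨ x ∈ s) → x ≠ z := by
        rintro x hx rfl
        exact hzW hx
      obtain ⟨T, hT, hconv⟩ := htc z
      obtain ⟨w, hw⟩ := hT.exists_mem_forall_of_pairwise_inter_nonempty
        (Finset.univ.filter fun x => x ∈ W ∨ x ∈ s) (fun x => {b | c x z (g x) b})
        (fun x hx => hT.isAcyclic.isPathConvex_of_induce_connected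
          (hconv x (hne x (by simpa using hx)) (g x) (hac x z (hne x (by simpa using hx)) (g x))))
        (by
          intro x hx y hy
          replace hx : x ∈ W ∨ x ∈ s := by simpa using hx
          replace hy : y ∈ W ∨ y ∈ s := by simpa using hy
          by_cases hxy : x = y
          · subst hxy
            obtain ⟨b, hb⟩ := hac x z (hne x hx) (g x)
            exact ⟨b, hb, hb⟩
          · obtain ⟨d, hd, hd'⟩ :=
              hpc x y z hxy (hne x hx) (hne y hy) (g x) (g y) (hg x y hx hy hxy)
            exact ⟨d, hd, (hinv z y (hne y hy).symm d (g y)).1 hd'⟩)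
      replace hw : ∀ x, (x ∈ W ∨ x ∈ s) → c x z (g x) w := fun x hx => hw x (by simpa using hx)
      refine ⟨Function.update g z w, fun x hx => ?_, fun x y hx hy hxy => ?_⟩
      · rw [Function.update_of_ne (hne x (Or.inl hx)), hgW x hx]
      · have hmem : ∀ x, (x ∈ W ∨ x ∈ insert z s) → x ≠ z → x ∈ W ∨ x ∈ s := by
          intro x hx hxz
          exact hx.imp_right fun h => (Finset.mem_insert.1 h).resolve_left hxz
        by_cases hxz : x = z
        · subst hxz
          have hyx : y ≠ x := hxy.symm
          rw [Function.update_self, Function.update_of_ne hyx]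
          exact (hinv y x hyx (g y) w).1 (hw y (hmem y hy hyx))
        · rw [Function.update_of_ne hxz]
          by_cases hyz : y = z
          · subst hyz
            rw [Function.update_self]
            exact hw x (hmem x hx hxz)
          · rw [Function.update_of_ne hyz]
            exact hg x y (hmem x hx hxz) (hmem y hy hyz) hxy
  obtain ⟨g, hgW, hg⟩ := key Finset.univ
  exact ⟨g, hgW, fun x y hxy => hg x y (by simp) (by simp) hxy⟩
end
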